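/- For every integer r ≥ 1 there is a constant κ_r > 0 with the following property. Let n ≥ π^r, let a₁, …, a_r generate ℤ/nℤ, let A be the transition operator of the type r walk with eigenvalues λ_k = (1/(2r+1))·(1 + 2·Σ_{i=1}^{r} cos(2π·k·a_i/n)), set |λ_m| = max_{k≠0}|λ_k| and assume |λ_m| < 1, and let d_A(t) = Σ_{g ∈ ℤ/nℤ} |p^{*t}(g) − 1/n|. Then for every t ≥ 1, d_A(t)² ≤ max{ κ_r / (|λ_m|^{−2t/(π²(2r+1))} − 1), κ_r / (|λ_m|^{−2t/(π²(2r+1))} − 1)^r }. -/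

import Mathlib

/-- Step distribution of the type `r` walk on `ZMod n` with step directions `a i`:
each of the elements `0, ±a i` is applied with probability `1/(2r+1)`
(multiplicities added when elements coincide). -/
noncomputable def stepDist (n r : ℕ) (a : Fin r → ZMod n) : ZMod n → ℝ :=
  fun g => (1 / (2 * (r : ℝ) + 1)) *
    ((if g = 0 then 1 else 0) +
      ∑ i : Fin r, ((if g = a i then (1 : ℝ) else 0) + (if g = -a i then 1 else 0)))

/-- `t`-fold convolution power of a distribution `p` on `ZMod n`. -/
noncomputable def convPow (n : ℕ) [NeZero n] (p : ZMod n → ℝ) : ℕ → ZMod n → ℝ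
  | 0 => fun g => if g = 0 then 1 else 0
  | t + 1 => fun g => ∑ h : ZMod n, p h * convPow n p t (g - h)

/-- Total variation distance of the type `r` walk from the uniform distribution after `t`
steps: `d_A(t) = ∑_g |p^{*t}(g) − 1/n|`. -/
noncomputable def dTV (n r : ℕ) [NeZero n] (a : Fin r → ZMod n) (t : ℕ) : ℝ :=
  ∑ g : ZMod n, |convPow n (stepDist n r a) t g - 1 / (n : ℝ)|

/-- The eigenvalue `λ_k = (1/(2r+1))·(1 + 2·∑_{i} cos(2π·k·a_i/n))` of the type `r` walk. -/
noncomputable def walkEig (n r : ℕ) (a : Fin r → ZMod n) (k : ZMod n) : ℝ :=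
  (1 / (2 * (r : ℝ) + 1)) *
    (1 + 2 * ∑ i : Fin r, Real.cos (2 * Real.pi * ((k * a i).val : ℝ) / n))

open Finset

lemma ZMod.stdAddChar_re_eq_cos {n : ℕ} [NeZero n] (m : ℤ) :
    (ZMod.stdAddChar (m : ZMod n)).re = Real.cos (2 * Real.pi * m / n) := by
  rw [ZMod.stdAddChar_coe]
  have : (2 * Real.pi * Complex.I * m / n : ℂ)
      = ((2 * Real.pi * m / n : ℝ) : ℂ) * Complex.I := by
    push_cast; ring
  rw [this, Complex.exp_ofReal_mul_I_re]

lemma ZMod.cos_val_eq {n : ℕ} [NeZero n] {x : ZMod n} {m : ℤ} (h : (m : ZMod n) = x) :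
    Real.cos (2 * Real.pi * (x.val : ℝ) / n) = Real.cos (2 * Real.pi * m / n) := by
  rw [← ZMod.stdAddChar_re_eq_cos (n := n) m, h]
  have := ZMod.stdAddChar_re_eq_cos (n := n) (x.val : ℤ)
  push_cast at this
  rw [← this, ZMod.natCast_zmod_val]

lemma ZMod.stdAddChar_add_neg {n : ℕ} [NeZero n] (x : ZMod n) :
    ZMod.stdAddChar x + ZMod.stdAddChar (-x)
      = ((2 * Real.cos (2 * Real.pi * (x.val : ℝ) / n) : ℝ) : ℂ) := by
  rw [AddChar.map_neg_eq_conj, Complex.add_conj]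
  have := ZMod.stdAddChar_re_eq_cos (n := n) (x.val : ℤ)
  push_cast at this
  rw [ZMod.natCast_zmod_val] at this
  rw [this]

/-- Parseval's identity on `ZMod n` for a real function with real Fourier coefficients. -/
lemma ZMod.sum_sq_eq_of_fourier {n : ℕ} [NeZero n] (f L : ZMod n → ℝ)
    (h : ∀ k, ∑ g, (f g : ℂ) * ZMod.stdAddChar (k * g) = (L k : ℂ)) :
    ∑ k, L k ^ 2 = n * ∑ g, f g ^ 2 := by
  have key : ∑ k, ((L k : ℂ)) ^ 2 = n * ∑ g, (f g : ℂ) ^ 2 := by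
    have h2 (k : ZMod n) : (L k : ℂ) ^ 2
        = ∑ g, ∑ g', (f g : ℂ) * f g' * ZMod.stdAddChar (k * (g - g')) := by
      rw [sq]
      nth_rewrite 2 [← Complex.conj_ofReal]
      rw [← h k, map_sum, Finset.sum_mul_sum]
      refine Finset.sum_congr rfl fun g _ => Finset.sum_congr rfl fun g' _ => ?_
      rw [map_mul (starRingEnd ℂ), ← AddChar.map_neg_eq_conj, Complex.conj_ofReal, mul_sub, sub_eq_add_neg,
        AddChar.map_add_eq_mul]
      ring
    simp_rw [h2]
    rw [Finset.sum_comm, Finset.mul_sum]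
    refine Finset.sum_congr rfl fun g _ => ?_
    rw [Finset.sum_comm]
    simp_rw [← Finset.mul_sum, AddChar.sum_mulShift _ (ZMod.isPrimitive_stdAddChar n), sub_eq_zero]
    simp
    ring
  exact_mod_cast key

lemma fourier_stepDist {n r : ℕ} [NeZero n] (a : Fin r → ZMod n) (k : ZMod n) :
    ∑ g, (stepDist n r a g : ℂ) * ZMod.stdAddChar (k * g) = (walkEig n r a k : ℂ) := by
  have : ∀ g, (stepDist n r a g : ℂ) * ZMod.stdAddChar (k * g)
      = (1 / (2 * (r : ℂ) + 1)) * ((if g = 0 then ZMod.stdAddChar (k * g) else 0) +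
      ∑ i : Fin r, ((if g = a i then ZMod.stdAddChar (k * g) else 0)
        + (if g = -a i then ZMod.stdAddChar (k * g) else 0))) := by
    intro g
    simp only [stepDist]
    push_cast
    rw [mul_assoc, add_mul, Finset.sum_mul]
    simp only [apply_ite Complex.ofReal, Complex.ofReal_one, Complex.ofReal_zero, add_mul,
      ite_mul, one_mul, zero_mul]
  simp_rw [this]
  rw [← Finset.mul_sum, Finset.sum_add_distrib, Finset.sum_comm]
  simp only [Finset.sum_add_distrib, Finset.sum_ite_eq', Finset.mem_univ, if_true]
  rw [← Finset.sum_add_distrib]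
  simp only [mul_neg, ZMod.stdAddChar_add_neg, walkEig]
  push_cast
  rw [← Finset.mul_sum]
  simp

lemma fourier_convPow {n r : ℕ} [NeZero n] (a : Fin r → ZMod n) (k : ZMod n) (t : ℕ) :
    ∑ g, (convPow n (stepDist n r a) t g : ℂ) * ZMod.stdAddChar (k * g)
      = ((walkEig n r a k ^ t : ℝ) : ℂ) := by
  induction t with
  | zero => simp [convPow, apply_ite Complex.ofReal]
  | succ t ih =>
    simp only [convPow]
    push_cast
    simp_rw [Finset.sum_mul]
    push_cast at ih
    rw [Finset.sum_comm, pow_succ', ← ih, ← fourier_stepDist, Finset.sum_mul]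
    refine Finset.sum_congr rfl fun h _ => ?_
    rw [Finset.mul_sum]
    refine Fintype.sum_equiv (Equiv.subRight h) _ _ fun g => ?_
    have : k * g = k * h + k * (g - h) := by ring
    rw [this, AddChar.map_add_eq_mul]
    simp
    ring

lemma walkEig_zero {n r : ℕ} [NeZero n] (a : Fin r → ZMod n) : walkEig n r a 0 = 1 := by
  have : (2 * (r : ℝ) + 1) ≠ 0 := by positivity
  simp [walkEig]
  field_simp
  ring

/-- The upper bound lemma: the squared distance to uniform is at most the sum of the
`2t`-th powers of the nontrivial eigenvalues. -/
lemma dTV_sq_le_sum {n r : ℕ} [NeZero n] (a : Fin r → ZMod n) (t : ℕ) :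
    dTV n r a t ^ 2 ≤ ∑ k ∈ univ.erase (0 : ZMod n), |walkEig n r a k| ^ (2 * t) := by
  have hn : (n : ℝ) ≠ 0 := by exact_mod_cast NeZero.ne n
  have hP := ZMod.sum_sq_eq_of_fourier
    (fun g => convPow n (stepDist n r a) t g - 1 / (n : ℝ))
    (fun k => if k = 0 then 0 else walkEig n r a k ^ t) (by
      intro k
      have hs : ∑ g : ZMod n, ZMod.stdAddChar (k * g) = if k = 0 then (n : ℂ) else 0 := by
        have := AddChar.sum_mulShift k (ZMod.isPrimitive_stdAddChar n)
        simp_rw [mul_comm k]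
        rw [this]; simp
      push_cast
      simp_rw [sub_mul]
      rw [Finset.sum_sub_distrib, fourier_convPow, ← Finset.mul_sum, hs]
      have hn' : (n : ℂ) ≠ 0 := by exact_mod_cast hn
      split_ifs with hk
      · subst hk; simp [walkEig_zero, hn']
      · simp)
  calc dTV n r a t ^ 2 ≤ n * ∑ g : ZMod n, |convPow n (stepDist n r a) t g - 1 / (n : ℝ)| ^ 2 := by
        have := sq_sum_le_card_mul_sum_sq (s := (univ : Finset (ZMod n)))
          (f := fun g => |convPow n (stepDist n r a) t g - 1 / (n : ℝ)|)
        simpa [dTV, ZMod.card] using this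
    _ = ∑ k : ZMod n, (if k = 0 then 0 else walkEig n r a k ^ t) ^ 2 := by
        simp_rw [sq_abs]; rw [hP]
    _ = _ := by
        rw [← Finset.add_sum_erase _ _ (Finset.mem_univ (0 : ZMod n))]
        simp only [if_true, ne_eq, OfNat.ofNat_ne_zero, not_false_eq_true, zero_pow, zero_add]
        refine Finset.sum_congr rfl fun k hk => ?_
        rw [if_neg (Finset.ne_of_mem_erase hk), ← pow_mul, mul_comm t, pow_mul, pow_mul, sq_abs]

lemma stepDist_sq_sum_ge {n r : ℕ} [NeZero n] (a : Fin r → ZMod n) :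
    1 / (2 * (r : ℝ) + 1) ≤ ∑ g, stepDist n r a g ^ 2 := by
  have hs : ∑ g, stepDist n r a g = 1 := by
    have := fourier_stepDist a 0
    simp only [zero_mul, AddChar.map_zero_eq_one, mul_one, walkEig_zero] at this
    exact_mod_cast this
  have hs' : 1 / (2 * (r : ℝ) + 1) = ∑ g, 1 / (2 * (r : ℝ) + 1) * stepDist n r a g := by
    rw [← Finset.mul_sum, hs, mul_one]
  rw [hs']
  refine Finset.sum_le_sum fun g _ => ?_
  obtain ⟨N, hN⟩ : ∃ N : ℕ, stepDist n r a g = 1 / (2 * (r : ℝ) + 1) * N := by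
    refine ⟨(if g = 0 then 1 else 0) +
      ∑ i : Fin r, ((if g = a i then 1 else 0) + (if g = -a i then 1 else 0)), ?_⟩
    simp [stepDist]
  rw [hN]
  have h1 : (N : ℝ) ≤ (N : ℝ) ^ 2 := by
    exact_mod_cast Nat.le_self_pow (by norm_num) N
  have h2 : 0 ≤ (1 / (2 * (r : ℝ) + 1)) ^ 2 := by positivity
  nlinarith [mul_le_mul_of_nonneg_left h1 h2]

/-- A uniform lower bound for the largest nontrivial eigenvalue when `n` exceeds the
number of steps. -/
lemma one_div_le_of_eig_le {n r : ℕ} [NeZero n] (a : Fin r → ZMod n) (hr : 1 ≤ r)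
    (hn : 2 * r + 2 ≤ n) {Λ : ℝ} (hΛ : 0 ≤ Λ) (h : ∀ k ≠ 0, |walkEig n r a k| ≤ Λ) :
    1 / (2 * (r : ℝ) + 1) ≤ Λ := by
  have hP := ZMod.sum_sq_eq_of_fourier _ _ (fourier_stepDist a)
  have hS := stepDist_sq_sum_ge a
  have hL : ∑ k, walkEig n r a k ^ 2 ≤ 1 + (n - 1) * Λ ^ 2 := by
    rw [← Finset.add_sum_erase _ _ (Finset.mem_univ (0 : ZMod n)), walkEig_zero]
    have : ∑ k ∈ univ.erase (0 : ZMod n), walkEig n r a k ^ 2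
        ≤ (univ.erase (0 : ZMod n)).card • Λ ^ 2 :=
      Finset.sum_le_card_nsmul _ _ _ fun k hk =>
        sq_le_sq' (abs_le.1 (h k (Finset.ne_of_mem_erase hk))).1
          (abs_le.1 (h k (Finset.ne_of_mem_erase hk))).2
    rw [Finset.card_erase_of_mem (Finset.mem_univ _), Finset.card_univ, ZMod.card, nsmul_eq_mul,
      Nat.cast_sub (by omega)] at this
    push_cast at this
    linarith
  have hn' : 2 * (r : ℝ) + 2 ≤ n := by exact_mod_cast hn
  have hR : (1 : ℝ) ≤ r := by exact_mod_cast hr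
  set D : ℝ := 2 * r + 1 with hD
  by_contra! hlt
  have hsq : Λ ^ 2 < (1 / D) ^ 2 := by gcongr
  have h1 : (n : ℝ) * (1 / D) ≤ 1 + (n - 1) * Λ ^ 2 := by
    refine le_trans ?_ hL
    rw [hP]; gcongr
  have h2 : (n : ℝ) * (1 / D) < 1 + (n - 1) * (1 / D) ^ 2 := by nlinarith
  have hD0 : 0 < D := by positivity
  have h3 : (n : ℝ) * D < D ^ 2 + (n - 1) := by
    have := mul_lt_mul_of_pos_right h2 (pow_pos hD0 2)
    field_simp at this
    nlinarith
  nlinarith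

lemma ZMod.abs_valMinAbs_div_le {n : ℕ} [NeZero n] (x : ZMod n) :
    |(x.valMinAbs : ℝ) / n| ≤ 1 / 2 := by
  have hn : (0 : ℝ) < n := by exact_mod_cast Nat.pos_of_ne_zero (NeZero.ne n)
  have h : 2 * x.valMinAbs.natAbs ≤ n := by
    have := ZMod.natAbs_valMinAbs_le x
    omega
  have h' : 2 * |(x.valMinAbs : ℝ)| ≤ n := by
    rw [← Int.cast_abs, Int.abs_eq_natAbs]
    exact_mod_cast h
  rw [abs_div, Nat.abs_cast, div_le_div_iff₀ hn two_pos]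
  linarith

lemma Real.cos_two_pi_mul_le {θ : ℝ} (h : |θ| ≤ 1 / 2) :
    Real.cos (2 * Real.pi * θ) ≤ 1 - 8 * θ ^ 2 := by
  have hpi := Real.pi_pos
  have h1 : |2 * Real.pi * θ| ≤ Real.pi := by
    rw [abs_mul, abs_of_pos (by positivity)]
    nlinarith
  refine (Real.cos_le_one_sub_mul_cos_sq h1).trans_eq ?_
  field_simp
  ring

/-- Gaussian upper bound for the eigenvalues in terms of the least absolute residues of the
`k * a i`. -/
lemma abs_walkEig_le_exp {n r : ℕ} [NeZero n] (a : Fin r → ZMod n) (hr : 1 ≤ r) (k : ZMod n) :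
    |walkEig n r a k| ≤ Real.exp (-(8 / (r * (2 * (r : ℝ) + 1)) *
      ∑ i, (((k * a i).valMinAbs : ℝ) / n) ^ 2)) := by
  have hR : (1 : ℝ) ≤ r := by exact_mod_cast hr
  set θ : Fin r → ℝ := fun i => ((k * a i).valMinAbs : ℝ) / n with hθ
  have habs (i) : |θ i| ≤ 1 / 2 := ZMod.abs_valMinAbs_div_le _
  have hcos (i) : Real.cos (2 * Real.pi * ((k * a i).val : ℝ) / n)
      = Real.cos (2 * Real.pi * θ i) := by
    rw [ZMod.cos_val_eq (ZMod.coe_valMinAbs (k * a i)), hθ, mul_div_assoc]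
  have hup : ∑ i, Real.cos (2 * Real.pi * ((k * a i).val : ℝ) / n) ≤ r - 8 * ∑ i, θ i ^ 2 := by
    calc _ ≤ ∑ i, (1 - 8 * θ i ^ 2) :=
          Finset.sum_le_sum fun i _ => (hcos i).trans_le (Real.cos_two_pi_mul_le (habs i))
      _ = _ := by simp [Finset.sum_sub_distrib, Finset.mul_sum]
  have hlow : -(r : ℝ) ≤ ∑ i, Real.cos (2 * Real.pi * ((k * a i).val : ℝ) / n) := by
    calc -(r : ℝ) = ∑ _i : Fin r, (-1 : ℝ) := by simp
      _ ≤ _ := Finset.sum_le_sum fun i _ => Real.neg_one_le_cos _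
  have hS : ∑ i, θ i ^ 2 ≤ r / 4 := by
    calc ∑ i, θ i ^ 2 ≤ ∑ _i : Fin r, (1 / 4 : ℝ) := Finset.sum_le_sum fun i _ => by
          have := sq_le_sq' (by linarith [habs i, abs_nonneg (θ i)]) (habs i)
          rw [sq_abs] at this
          linarith
      _ = _ := by simp; ring
  have hS0 : 0 ≤ ∑ i, θ i ^ 2 := Finset.sum_nonneg fun i _ => sq_nonneg _
  set S := ∑ i, θ i ^ 2
  set C := ∑ i, Real.cos (2 * Real.pi * ((k * a i).val : ℝ) / n) with hC
  have hw : walkEig n r a k = (1 + 2 * C) / (2 * r + 1) := by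
    rw [walkEig, ← hC]; ring
  have hle : |walkEig n r a k| ≤ 1 - 8 / (r * (2 * (r : ℝ) + 1)) * S := by
    have e : 1 - 8 / (r * (2 * (r : ℝ) + 1)) * S = (2 * r + 1 - 8 * (S / r)) / (2 * r + 1) := by
      field_simp
    have h1 : S / r ≤ S := div_le_self hS0 hR
    have h2 : S / r ≤ 1 / 4 := by
      rw [div_le_div_iff₀ (by linarith) (by norm_num)]; linarith
    rw [hw, e, abs_div, abs_of_pos (by positivity : (0 : ℝ) < 2 * r + 1)]
    gcongr
    rw [abs_le]
    have h3 : 0 ≤ S / r := by positivity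
    constructor <;> linarith
  refine hle.trans ?_
  linarith [Real.add_one_le_exp (-(8 / (r * (2 * (r : ℝ) + 1)) * S))]

/-- If `k` and `j` have close residues then `k - j` has a large eigenvalue. -/
lemma lt_walkEig_sub {n r : ℕ} [NeZero n] (a : Fin r → ZMod n) {k j : ZMod n}
    {δ : ℝ} (hδ : 0 < δ)
    (h : ∀ i, |((k * a i).valMinAbs : ℝ) / n - ((j * a i).valMinAbs : ℝ) / n| ≤ δ) :
    1 - 2 * Real.pi ^ 2 * δ ^ 2 < walkEig n r a (k - j) := by
  have hcos (i) : 1 - 2 * Real.pi ^ 2 * δ ^ 2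
      ≤ Real.cos (2 * Real.pi * (((k - j) * a i).val : ℝ) / n) := by
    have hc : (((k * a i).valMinAbs - (j * a i).valMinAbs : ℤ) : ZMod n) = (k - j) * a i := by
      push_cast [ZMod.coe_valMinAbs]; ring
    rw [ZMod.cos_val_eq hc]
    refine le_trans ?_ (Real.one_sub_sq_div_two_le_cos)
    have h2 := sq_le_sq' (by linarith [h i, abs_nonneg (((k * a i).valMinAbs : ℝ) / n
      - ((j * a i).valMinAbs : ℝ) / n)]) (h i)
    rw [sq_abs] at h2
    have e : (2 * Real.pi * (((k * a i).valMinAbs - (j * a i).valMinAbs : ℤ) : ℝ) / n) ^ 2 / 2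
        = 2 * Real.pi ^ 2 *
          (((k * a i).valMinAbs : ℝ) / n - ((j * a i).valMinAbs : ℝ) / n) ^ 2 := by
      push_cast; ring
    rw [e]
    have := Real.pi_pos
    gcongr
  have hsum : r * (1 - 2 * Real.pi ^ 2 * δ ^ 2)
      ≤ ∑ i, Real.cos (2 * Real.pi * (((k - j) * a i).val : ℝ) / n) := by
    calc _ = ∑ _i : Fin r, (1 - 2 * Real.pi ^ 2 * δ ^ 2) := by
          rw [Finset.sum_const, Finset.card_fin, nsmul_eq_mul]
      _ ≤ _ := Finset.sum_le_sum fun i _ => hcos i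
  have hp : 0 < Real.pi ^ 2 * δ ^ 2 := by have := Real.pi_pos; positivity
  rw [walkEig, one_div, inv_mul_eq_div, lt_div_iff₀ (by positivity)]
  linarith

lemma sum_exp_neg_mul_abs_le {β : ℝ} (hβ : 0 < β) (S : Finset ℤ) :
    ∑ m ∈ S, Real.exp (-(β * |(m : ℝ)|)) ≤ 2 * (1 + 1 / β) := by
  set q := Real.exp (-β) with hq
  have hq0 : 0 < q := Real.exp_pos _
  have hq1 : q < 1 := Real.exp_lt_one_iff.2 (by linarith)
  have hg := hasSum_geometric_of_lt_one hq0.le hq1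
  have hpow (j : ℕ) : Real.exp (-(β * j)) = q ^ j := by
    rw [hq, ← Real.exp_nat_mul]; congr 1; ring
  have hs : HasSum (fun m : ℤ => Real.exp (-(β * |(m : ℝ)|))) ((1 - q)⁻¹ + q * (1 - q)⁻¹) := by
    refine HasSum.of_nat_of_neg_add_one ?_ ?_
    · simpa [hpow] using hg
    · refine (hg.mul_left q).congr_fun fun j => ?_
      rw [← pow_succ', ← hpow]
      push_cast
      rw [abs_neg, abs_of_nonneg (by positivity)]
  refine (sum_le_hasSum S (fun _ _ => (Real.exp_pos _).le) hs).trans ?_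
  have h1 : q * (1 + β) ≤ 1 := by
    have := Real.add_one_le_exp β
    calc q * (1 + β) ≤ q * Real.exp β := by gcongr; linarith
      _ = 1 := by rw [hq, ← Real.exp_add]; simp
  have h2 : (1 - q)⁻¹ ≤ 1 + 1 / β := by
    rw [inv_le_comm₀ (by linarith) (by positivity)]
    have : (1 + 1 / β)⁻¹ = β / (1 + β) := by field_simp; ring
    rw [this, div_le_iff₀ (by positivity)]
    nlinarith
  have h3 : 0 < (1 - q)⁻¹ := inv_pos.2 (by linarith)
  nlinarith

lemma sum_exp_neg_mul_sum_abs_le {K : Type*} [Fintype K] {r : ℕ} {m : K → Fin r → ℤ}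
    (hm : Function.Injective m) {β : ℝ} (hβ : 0 < β) :
    ∑ k, Real.exp (-(β * ∑ i, |(m k i : ℝ)|)) ≤ (2 * (1 + 1 / β)) ^ r := by
  set S : Finset ℤ := univ.image fun p : K × Fin r => m p.1 p.2 with hS
  have hprod (v : Fin r → ℤ) : Real.exp (-(β * ∑ i, |(v i : ℝ)|))
      = ∏ i, Real.exp (-(β * |(v i : ℝ)|)) := by
    rw [← Real.exp_sum, Finset.mul_sum, Finset.sum_neg_distrib]
  calc ∑ k, Real.exp (-(β * ∑ i, |(m k i : ℝ)|))
      = ∑ v ∈ univ.map ⟨m, hm⟩, ∏ i, Real.exp (-(β * |(v i : ℝ)|)) := by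
        simp [Finset.sum_map, hprod]
    _ ≤ ∑ v ∈ Fintype.piFinset fun _ : Fin r => S, ∏ i, Real.exp (-(β * |(v i : ℝ)|)) := by
        refine Finset.sum_le_sum_of_subset_of_nonneg ?_ fun v _ _ =>
          Finset.prod_nonneg fun i _ => (Real.exp_pos _).le
        intro v hv
        obtain ⟨k, -, rfl⟩ := Finset.mem_map.1 hv
        exact Fintype.mem_piFinset.2 fun i =>
          Finset.mem_image.2 ⟨(k, i), Finset.mem_univ _, rfl⟩
    _ = ∏ _i : Fin r, ∑ j ∈ S, Real.exp (-(β * |(j : ℝ)|)) :=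
        (Finset.prod_univ_sum (fun _ : Fin r => S)
          fun _ (j : ℤ) => Real.exp (-(β * |(j : ℝ)|))).symm
    _ = (∑ j ∈ S, Real.exp (-(β * |(j : ℝ)|))) ^ r := by simp
    _ ≤ _ := pow_le_pow_left₀ (Finset.sum_nonneg fun _ _ => (Real.exp_pos _).le)
        (sum_exp_neg_mul_abs_le hβ S) r

lemma abs_round_le_four_mul_sq (x : ℝ) : |(round x : ℝ)| ≤ 4 * x ^ 2 := by
  have h := abs_sub_round x
  rcases eq_or_ne (round x) 0 with h0 | h0
  · rw [h0]; simp; positivity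
  · have h1 : (1 : ℝ) ≤ |(round x : ℝ)| := by exact_mod_cast Int.one_le_abs h0
    have h2 : |(round x : ℝ)| ≤ 2 * |x| := by
      have := abs_sub_abs_le_abs_sub (round x : ℝ) x
      rw [abs_sub_comm] at this
      linarith
    rw [← sq_abs x]
    nlinarith

/-- Bound on the sum of the `t`-th powers of the eigenvalues in terms of the spectral gap. -/
lemma sum_abs_walkEig_pow_le {n r : ℕ} [NeZero n] (a : Fin r → ZMod n) (hr : 1 ≤ r)
    {Λ : ℝ} (hΛ : Λ < 1) (h : ∀ k ≠ 0, |walkEig n r a k| ≤ Λ) {t : ℕ} (ht : 1 ≤ t) :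
    ∑ k, |walkEig n r a k| ^ t ≤
      (2 * (1 + 1 / (t * (1 - Λ) / (2 * Real.pi ^ 2 * (r * (2 * (r : ℝ) + 1)))))) ^ r := by
  have hpi := Real.pi_pos
  have hR : (1 : ℝ) ≤ r := by exact_mod_cast hr
  have hT : (1 : ℝ) ≤ t := by exact_mod_cast ht
  have hgap : 0 < 1 - Λ := by linarith
  set δ := Real.sqrt ((1 - Λ) / (4 * Real.pi ^ 2)) with hδ_def
  have hδ : 0 < δ := Real.sqrt_pos.2 (by positivity)
  have hδ2 : δ ^ 2 = (1 - Λ) / (4 * Real.pi ^ 2) := Real.sq_sqrt (by positivity)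
  set θ : ZMod n → Fin r → ℝ := fun k i => ((k * a i).valMinAbs : ℝ) / n with hθ
  set m : ZMod n → Fin r → ℤ := fun k i => round (θ k i / δ) with hm_def
  have hm : Function.Injective m := by
    intro k j hkj
    by_contra hne
    have hclose (i) : |θ k i - θ j i| ≤ δ := by
      have h1 := abs_sub_round (θ k i / δ)
      have h2 := abs_sub_round (θ j i / δ)
      have h3 : round (θ k i / δ) = round (θ j i / δ) := congrFun hkj i
      rw [← h3] at h2
      have h4 : |θ k i / δ - θ j i / δ| ≤ 1 := by
        rw [abs_le] at *
        constructor <;> linarith [h1.1, h1.2, h2.1, h2.2]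
      rwa [← sub_div, abs_div, abs_of_pos hδ, div_le_one hδ] at h4
    have h1 := lt_walkEig_sub a hδ hclose
    have h2 := (le_abs_self _).trans (h (k - j) (sub_ne_zero.2 hne))
    have h3 : 2 * Real.pi ^ 2 * δ ^ 2 = (1 - Λ) / 2 := by rw [hδ2]; field_simp; ring
    linarith
  set β := t * (1 - Λ) / (2 * Real.pi ^ 2 * (r * (2 * (r : ℝ) + 1))) with hβ_def
  have hβ : 0 < β := by positivity
  refine le_trans (Finset.sum_le_sum fun k _ => ?_) (sum_exp_neg_mul_sum_abs_le hm hβ)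
  calc |walkEig n r a k| ^ t
      ≤ Real.exp (-(8 / (r * (2 * (r : ℝ) + 1)) * ∑ i, θ k i ^ 2)) ^ t :=
        pow_le_pow_left₀ (abs_nonneg _) (abs_walkEig_le_exp a hr k) t
    _ = Real.exp (-(t * (8 / (r * (2 * (r : ℝ) + 1))) * ∑ i, θ k i ^ 2)) := by
        rw [← Real.exp_nat_mul]; congr 1; ring
    _ ≤ _ := by
        refine Real.exp_le_exp.2 (neg_le_neg ?_)
        have e : t * (8 / (r * (2 * (r : ℝ) + 1))) = β * (4 / δ ^ 2) := by
          rw [hδ2, hβ_def]; field_simp; ring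
        rw [e, mul_assoc, Finset.mul_sum (a := 4 / δ ^ 2)]
        refine mul_le_mul_of_nonneg_left (Finset.sum_le_sum fun i _ => ?_) hβ.le
        refine (abs_round_le_four_mul_sq _).trans_eq ?_
        rw [div_pow]; ring

lemma two_mul_add_two_le_of_pi_pow_le {n r : ℕ} (hr : 1 ≤ r) (h : Real.pi ^ r ≤ (n : ℝ)) :
    2 * r + 2 ≤ n := by
  have h3 : (3 : ℝ) ^ r < Real.pi ^ r :=
    pow_lt_pow_left₀ Real.pi_gt_three (by norm_num) (by omega)
  have h4 : 1 + (r : ℝ) * 2 ≤ (1 + 2) ^ r := one_add_mul_le_pow (by norm_num) r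
  have h5 : (1 + (r : ℝ) * 2) < n := by norm_num at h4 ⊢; linarith
  have : 1 + r * 2 < n := by exact_mod_cast h5
  omega

/-- The elementary comparison turning an exponentially decaying bound into the stated maximum. -/
lemma exp_neg_mul_pow_le_max {y B : ℝ} (hy : 0 < y) (hB : 0 ≤ B) {r : ℕ} :
    Real.exp (-y) * (2 * (1 + B / y)) ^ r ≤
      max ((2 + 4 * B) ^ r / (Real.exp y - 1)) ((2 + 4 * B) ^ r / (Real.exp y - 1) ^ r) := by
  set x := Real.exp y with hx
  have hx1 : 1 < x := Real.one_lt_exp_iff.2 hy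
  have hinv : Real.exp (-y) = x⁻¹ := Real.exp_neg y
  have hlow : 1 - x⁻¹ ≤ y := by rw [← hinv]; linarith [Real.add_one_le_exp (-y)]
  have hu : 0 < x - 1 := by linarith
  rw [hinv]
  rcases le_total 2 x with h2 | h2
  · refine le_max_of_le_left ?_
    have hxi : x⁻¹ ≤ 2⁻¹ := by gcongr
    have hy2 : 1 / 2 ≤ y := by linarith
    have h3 : B / y ≤ 2 * B := by
      rw [div_le_iff₀ hy]; nlinarith
    rw [div_eq_inv_mul _ (x - 1)]
    have h0 : 0 ≤ B / y := by positivity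
    gcongr
    · linarith
    · linarith
  · refine le_max_of_le_right ?_
    have hyx : (x - 1) / 2 ≤ y := by
      have : x - 1 ≤ y * x := by
        have := mul_le_mul_of_nonneg_right hlow (by linarith : 0 ≤ x)
        rwa [sub_mul, one_mul, inv_mul_cancel₀ (by linarith)] at this
      nlinarith
    have h0 : 0 ≤ B / y := by positivity
    have h3 : 2 * (1 + B / y) ≤ (2 + 4 * B) / (x - 1) := by
      have h4 : B / y ≤ B / ((x - 1) / 2) := by gcongr
      have h5 : B / ((x - 1) / 2) = 2 * B / (x - 1) := by field_simp
      have h6 : 2 ≤ 2 / (x - 1) := by rw [le_div_iff₀ hu]; linarith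
      have h7 : (2 + 4 * B) / (x - 1) = 2 / (x - 1) + 2 * (2 * B / (x - 1)) := by ring
      linarith
    calc x⁻¹ * (2 * (1 + B / y)) ^ r ≤ 1 * ((2 + 4 * B) / (x - 1)) ^ r := by
          gcongr
          exact inv_le_one_of_one_le₀ hx1.le
      _ = _ := by rw [one_mul, div_pow]

/-- For every `r ≥ 1` there is `κ_r > 0` such that every type `r` walk on `ℤ/nℤ`
(`n ≥ π^r`, generators `a₁, …, a_r`, `|λ_m| = max_{k≠0}|λ_k| < 1`) satisfies, for all `t ≥ 1`,
`d_A(t)² ≤ max{κ_r/(|λ_m|^{−2t/(π²(2r+1))} − 1), κ_r/(|λ_m|^{−2t/(π²(2r+1))} − 1)^r}`. -/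
theorem dist_sq_le_of_walk (r : ℕ) (hr : 1 ≤ r) :
    ∃ κ : ℝ, 0 < κ ∧
      ∀ (n : ℕ) [NeZero n] (a : Fin r → ZMod n), Real.pi ^ r ≤ (n : ℝ) →
        AddSubgroup.closure (Set.range a) = ⊤ →
        ∀ lamm : ℝ,
          IsGreatest {x : ℝ | ∃ k : ZMod n, k ≠ 0 ∧ x = |walkEig n r a k|} lamm →
          lamm < 1 →
          ∀ t : ℕ, 1 ≤ t →
            dTV n r a t ^ 2 ≤
              max (κ / (lamm ^ (-(2 * (t : ℝ)) / (Real.pi ^ 2 * (2 * (r : ℝ) + 1))) - 1))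
                (κ / ((lamm ^ (-(2 * (t : ℝ)) / (Real.pi ^ 2 * (2 * (r : ℝ) + 1))) - 1) ^ r)) := by
  have hR : (1 : ℝ) ≤ r := by exact_mod_cast hr
  have hpi := Real.pi_pos
  set D : ℝ := 2 * r + 1 with hD
  have hD1 : 1 ≤ D := by linarith
  set B : ℝ := 4 * (r * D) with hB
  refine ⟨(2 + 4 * B) ^ r, by positivity, ?_⟩
  intro n _ a hn _ Λ hΛ hΛ1 t ht
  have hT : (1 : ℝ) ≤ t := by exact_mod_cast ht
  have hle : ∀ k ≠ 0, |walkEig n r a k| ≤ Λ := fun k hk => hΛ.2 ⟨k, hk, rfl⟩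
  have hΛ0 : 0 ≤ Λ := by
    obtain ⟨k, -, rfl⟩ := hΛ.1
    exact abs_nonneg _
  have hΛD : 1 / D ≤ Λ :=
    one_div_le_of_eig_le a hr (two_mul_add_two_le_of_pi_pow_le hr hn) hΛ0 hle
  have hΛpos : 0 < Λ := lt_of_lt_of_le (by positivity) hΛD
  have hlog : Real.log Λ < 0 := Real.log_neg hΛpos hΛ1
  set y : ℝ := -Real.log Λ * (2 * t / (Real.pi ^ 2 * D)) with hy_def
  have hy : 0 < y := mul_pos (by linarith) (by positivity)
  have hx : Λ ^ (-(2 * (t : ℝ)) / (Real.pi ^ 2 * D)) = Real.exp y := by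
    rw [Real.rpow_def_of_pos hΛpos, hy_def]; congr 1; ring
  rw [hx]
  have hgap : -Real.log Λ ≤ D * (1 - Λ) := by
    have h1 := Real.log_le_sub_one_of_pos (inv_pos.2 hΛpos)
    rw [Real.log_inv] at h1
    have h2 : Λ⁻¹ ≤ D := by
      rw [inv_le_comm₀ hΛpos (by linarith), ← one_div]; exact hΛD
    have h3 : Λ⁻¹ - 1 = Λ⁻¹ * (1 - Λ) := by field_simp
    nlinarith
  have hdecay : Λ ^ t ≤ Real.exp (-y) := by
    rw [← Real.exp_log (pow_pos hΛpos t), Real.log_pow]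
    refine Real.exp_le_exp.2 ?_
    have h1 : 2 * t / (Real.pi ^ 2 * D) ≤ t := by
      rw [div_le_iff₀ (by positivity)]
      have h2 : 2 ≤ Real.pi ^ 2 * D := by nlinarith [Real.pi_gt_three]
      nlinarith
    rw [hy_def]
    nlinarith
  have hβ : y / B ≤ t * (1 - Λ) / (2 * Real.pi ^ 2 * (r * D)) := by
    calc y / B ≤ D * (1 - Λ) * (2 * t / (Real.pi ^ 2 * D)) / B := by
          rw [hy_def]; gcongr
      _ = _ := by rw [hB]; field_simp; ring
  calc dTV n r a t ^ 2 ≤ ∑ k ∈ univ.erase (0 : ZMod n), |walkEig n r a k| ^ (2 * t) :=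
        dTV_sq_le_sum a t
    _ ≤ ∑ k ∈ univ.erase (0 : ZMod n), Real.exp (-y) * |walkEig n r a k| ^ t := by
        refine Finset.sum_le_sum fun k hk => ?_
        rw [two_mul, pow_add]
        gcongr
        exact (pow_le_pow_left₀ (abs_nonneg _) (hle k (Finset.ne_of_mem_erase hk)) t).trans hdecay
    _ ≤ Real.exp (-y) * ∑ k, |walkEig n r a k| ^ t := by
        rw [← Finset.mul_sum]
        gcongr
        exact Finset.erase_subset _ _
    _ ≤ Real.exp (-y) * (2 * (1 + B / y)) ^ r := by
        gcongr
        refine (sum_abs_walkEig_pow_le a hr hΛ1 hle ht).trans ?_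
        have : 1 / (t * (1 - Λ) / (2 * Real.pi ^ 2 * (r * D))) ≤ B / y := by
          rw [← one_div_div y B]
          gcongr
        have h0 : 0 < 1 - Λ := by linarith
        gcongr
    _ ≤ _ := exp_neg_mul_pow_le_max hy (by positivity)
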